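/- Let $\mathcal{P}_q$ be defined on $\binom{r}{q-1}$-tuples of smooth functions indexed by antisymmetric multi-indices by $(\mathcal{P}_q f)_J = \sum_{j\in J}(-1)^{(j,J\setminus j)} P_j f_{J\setminus j} - \sum_{m<n\in J}\mathrm{sgn}\binom{J}{mn\,J\setminus\{m,n\}} c_{mn}^s f_{s\,J\setminus\{m,n\}}$ for strictly increasing $J$ with $|J|=q$. Under assumptions (A1) and (A2), $\mathcal{P}_{q+1}\circ\mathcal{P}_q = 0$ for all $1\le q\le r$. -/

import Mathlib

open Finset

noncomputable section

/-- The ambient Euclidean space `ℝⁿ`. -/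
abbrev Euc (n : ℕ) := Fin n → ℝ

/-- Partial derivative `∂ν`. -/
def pd {n : ℕ} (ν : Fin n) (g : Euc n → ℂ) (x : Euc n) : ℂ :=
  fderiv ℝ g x (Pi.single ν 1)

/-- The principal part `p_j = Σ a_j^ν ∂_ν`. -/
def pOp {n r : ℕ} (a : Fin r → Fin n → Euc n → ℂ) (j : Fin r) (g : Euc n → ℂ)
    (x : Euc n) : ℂ :=
  ∑ ν, a j ν x * pd ν g x

/-- The first order operator `P_j = Σ a_j^ν ∂_ν + a_j^0`. -/
def POp {n r : ℕ} (a : Fin r → Fin n → Euc n → ℂ) (a0 : Fin r → Euc n → ℂ) (j : Fin r)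
    (g : Euc n → ℂ) (x : Euc n) : ℂ :=
  pOp a j g x + a0 j x * g x


/-- The compatibility operator `𝒫` from level `m` to level `m+1`, acting on antisymmetric
tuples: `(𝒫 f)_J = Σ_{j∈J} (-1)^{(j,J∖j)} P_j f_{J∖j}
− Σ_{m<n∈J} sgn(J ↦ mnJ∖{m,n}) c_{mn}^s f_{sJ∖{m,n}}`,
written in terms of positions in the tuple `J`. -/
def PP {n r : ℕ} (a : Fin r → Fin n → Euc n → ℂ) (a0 : Fin r → Euc n → ℂ)
    (c : Fin r → Fin r → Fin r → Euc n → ℂ) (m : ℕ)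
    (f : (Fin m → Fin r) → Euc n → ℂ) : (Fin (m + 1) → Fin r) → Euc n → ℂ :=
  fun J x =>
    (∑ i : Fin (m + 1), (-1 : ℂ) ^ (i : ℕ) * POp a a0 (J i) (f (J ∘ i.succAbove)) x) -
      ∑ i : Fin (m + 1), ∑ j : Fin (m + 1),
        if hij : (i : ℕ) < (j : ℕ) then
          have hm : m - 1 + 1 = m := by have := j.isLt; omega
          (-1 : ℂ) ^ ((i : ℕ) + (j : ℕ) + 1) *
            ∑ s : Fin r, c (J i) (J j) s x *
              f ((Fin.cons s (((J ∘ j.succAbove) ∘ Fin.cast hm) ∘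
                  Fin.succAbove ⟨(i : ℕ), by have := j.isLt; omega⟩)) ∘ Fin.cast hm.symm) x
        else 0

/-- First order operators `P j` over a commutative ring, with derivation parts `p j`, which are
in involution with structure functions `c` satisfying the Jacobi identity. -/
structure InvolutiveSystem (ι A : Type*) [Fintype ι] [CommRing A] where
  P : ι → A → A
  p : ι → A → A
  c : ι → ι → ι → A
  P_add : ∀ j g h, P j (g + h) = P j g + P j h
  P_mul : ∀ j g h, P j (g * h) = p j g * h + g * P j h
  c_antisymm : ∀ j k l, c j k l = -c k j l
  bracket : ∀ j k g, P j (P k g) - P k (P j g) = ∑ l, c j k l * P l g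
  jacobi : ∀ k k' l' l, (∑ s, c k k' s * c s l' l) + (∑ s, c k' l' s * c s k l) +
    (∑ s, c l' k s * c s k' l) = p l' (c k k' l) + p k (c k' l' l) + p k' (c l' k l)

/-- A function of lists is antisymmetric if it changes sign under adjacent transpositions. -/
def ListAntisymm {ι A : Type*} [Neg A] (f : List ι → A) : Prop :=
  ∀ pre a b l, f (pre ++ a :: b :: l) = -f (pre ++ b :: a :: l)

theorem ListAntisymm.cons {ι A : Type*} [Neg A] {f : List ι → A} (hf : ListAntisymm f) (k : ι) :
    ListAntisymm fun l => f (k :: l) :=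
  fun pre a b l => hf (k :: pre) a b l

theorem ListAntisymm.swap {ι A : Type*} [Neg A] {f : List ι → A} (hf : ListAntisymm f)
    (a b : ι) (l : List ι) : f (a :: b :: l) = -f (b :: a :: l) :=
  hf [] a b l

namespace InvolutiveSystem

variable {ι A : Type*} [Fintype ι] [CommRing A] (S : InvolutiveSystem ι A)

/-- The Lie derivative of a cochain along `P k`. -/
def lie (k : ι) : (List ι → A) → List ι → A
  | f, [] => S.P k (f [])
  | f, j :: l => lie k (fun l => f (j :: l)) l - ∑ s, S.c k j s * f (s :: l)

/-- The differential, defined through Cartan's formula. -/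
def diff : (List ι → A) → List ι → A
  | _, [] => 0
  | f, k :: l => S.lie k f l - diff (fun l => f (k :: l)) l

/-- The wedge product of the differential of a ring element with a cochain. -/
def wedge (g : A) : (List ι → A) → List ι → A
  | _, [] => 0
  | f, k :: l => S.p k g * f l - wedge g (fun l => f (k :: l)) l

theorem P_zero (j : ι) : S.P j 0 = 0 := by
  have := S.P_add j 0 0
  simpa using this

theorem P_neg (j : ι) (g : A) : S.P j (-g) = -S.P j g := by
  have := S.P_add j g (-g)
  rw [add_neg_cancel, P_zero] at this
  linear_combination -this

theorem P_sub (j : ι) (g h : A) : S.P j (g - h) = S.P j g - S.P j h := by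
  rw [sub_eq_add_neg, P_add, P_neg, sub_eq_add_neg]

theorem P_sum {κ : Type*} (t : Finset κ) (j : ι) (g : κ → A) :
    S.P j (∑ s ∈ t, g s) = ∑ s ∈ t, S.P j (g s) := by
  classical
  induction t using Finset.induction_on with
  | empty => simp [P_zero]
  | insert a t ha ih => rw [Finset.sum_insert ha, Finset.sum_insert ha, P_add, ih]

theorem p_neg (j : ι) (g : A) : S.p j (-g) = -S.p j g := by
  have h1 := S.P_mul j (-g) 1
  have h2 := S.P_mul j g 1
  rw [mul_one, P_neg] at h1
  rw [mul_one] at h2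
  linear_combination -h1 - h2

theorem lie_sub (k : ι) (u v : List ι → A) (l : List ι) :
    S.lie k (fun l => u l - v l) l = S.lie k u l - S.lie k v l := by
  induction l generalizing u v with
  | nil => exact S.P_sub k _ _
  | cons j l ih =>
    simp only [lie, ih, mul_sub, Finset.sum_sub_distrib]
    ring

theorem lie_neg (k : ι) (u : List ι → A) (l : List ι) :
    S.lie k (fun l => -u l) l = -S.lie k u l := by
  induction l generalizing u with
  | nil => exact S.P_neg k _
  | cons j l ih =>
    simp only [lie, ih, mul_neg, Finset.sum_neg_distrib]
    ring

theorem lie_sum_mul (k : ι) (g : ι → A) (u : ι → List ι → A) (l : List ι) :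
    S.lie k (fun l => ∑ s, g s * u s l) l =
      (∑ s, S.p k (g s) * u s l) + ∑ s, g s * S.lie k (u s) l := by
  induction l generalizing u with
  | nil => simp only [lie, P_sum, P_mul, Finset.sum_add_distrib]
  | cons j l ih =>
    simp only [lie, ih, mul_sub, Finset.sum_sub_distrib, Finset.mul_sum]
    rw [Finset.sum_comm, add_sub_assoc]
    simp only [mul_left_comm]

theorem diff_sub (u v : List ι → A) (l : List ι) :
    S.diff (fun l => u l - v l) l = S.diff u l - S.diff v l := by
  induction l generalizing u v with
  | nil => simp [diff]
  | cons k l ih =>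
    simp only [diff, ih, lie_sub]
    ring

theorem diff_neg (u : List ι → A) (l : List ι) :
    S.diff (fun l => -u l) l = -S.diff u l := by
  induction l generalizing u with
  | nil => simp [diff]
  | cons k l ih =>
    simp only [diff, ih, lie_neg]
    ring

theorem diff_sum_mul (g : ι → A) (u : ι → List ι → A) (l : List ι) :
    S.diff (fun l => ∑ s, g s * u s l) l =
      (∑ s, S.wedge (g s) (u s) l) + ∑ s, g s * S.diff (u s) l := by
  induction l generalizing u with
  | nil => simp [diff, wedge]
  | cons k l ih =>
    simp only [diff, wedge, ih, lie_sum_mul, mul_sub, Finset.sum_sub_distrib]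
    ring

theorem wedge_neg (g : A) (u : List ι → A) (l : List ι) :
    S.wedge g (fun l => -u l) l = -S.wedge g u l := by
  induction l generalizing u with
  | nil => simp [wedge]
  | cons k l ih =>
    simp only [wedge, ih]
    ring

theorem lie_antisymm (k : ι) {f : List ι → A} (hf : ListAntisymm f) :
    ListAntisymm (S.lie k f) := by
  intro pre
  induction pre generalizing f with
  | nil =>
    intro a b l
    have h : (fun l => f (a :: b :: l)) = fun l => -f (b :: a :: l) := funext fun l => hf.swap a b l
    simp only [List.nil_append, lie, h, lie_neg]
    simp only [fun s => hf.swap a s l, fun s => hf.swap b s l, mul_neg, Finset.sum_neg_distrib]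
    ring
  | cons j pre ih =>
    intro a b l
    have h (s : ι) : f (s :: (pre ++ a :: b :: l)) = -f (s :: (pre ++ b :: a :: l)) :=
      hf (s :: pre) a b l
    simp only [List.cons_append, lie, ih (hf.cons j) a b l, h, mul_neg, Finset.sum_neg_distrib]
    ring

theorem diff_antisymm {f : List ι → A} (hf : ListAntisymm f) : ListAntisymm (S.diff f) := by
  intro pre
  induction pre generalizing f with
  | nil =>
    intro a b l
    have h : (fun l => f (a :: b :: l)) = fun l => -f (b :: a :: l) := funext fun l => hf.swap a b l
    simp only [List.nil_append, diff, lie, h, diff_neg]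
    simp only [S.c_antisymm a b, neg_mul, Finset.sum_neg_distrib]
    ring
  | cons j pre ih =>
    intro a b l
    simp only [List.cons_append, diff, ih (hf.cons j) a b l, S.lie_antisymm j hf pre a b l]
    ring

/-- The commutator of two Lie derivatives. -/
theorem lie_lie_sub (k j : ι) {f : List ι → A} (hf : ListAntisymm f) (l : List ι) :
    S.lie k (S.lie j f) l - S.lie j (S.lie k f) l =
      (∑ s, S.c k j s * S.lie s f l) +
        ∑ s, S.wedge (S.c k j s) (fun l => f (s :: l)) l := by
  induction l generalizing f with
  | nil => simpa [lie, wedge] using S.bracket k j (f [])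
  | cons i l ih =>
    have h (s : ι) : (fun l => f (s :: i :: l)) = fun l => -f (i :: s :: l) :=
      funext fun l => hf.swap s i l
    have key := ih (hf.cons i)
    simp only [lie, wedge, lie_sub, lie_sum_mul, mul_sub, Finset.sum_sub_distrib, Finset.mul_sum,
      h, wedge_neg, Finset.sum_neg_distrib]
    have hj : (∑ t, (∑ s, S.c k j s * S.c s i t) * f (t :: l)) +
        (∑ t, (∑ s, S.c k i s * S.c j s t) * f (t :: l)) -
        (∑ t, (∑ s, S.c j i s * S.c k s t) * f (t :: l)) =
        (∑ t, S.p i (S.c k j t) * f (t :: l)) + (∑ t, S.p k (S.c j i t) * f (t :: l)) -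
        ∑ t, S.p j (S.c k i t) * f (t :: l) := by
      simp only [← Finset.sum_add_distrib, ← Finset.sum_sub_distrib, ← add_mul, ← sub_mul]
      refine Finset.sum_congr rfl fun t _ => ?_
      congr 1
      have e := S.jacobi k j i t
      rw [S.c_antisymm i k t, p_neg] at e
      have e1 : ∑ s, S.c j i s * S.c s k t = -∑ s, S.c j i s * S.c k s t := by
        simp_rw [← Finset.sum_neg_distrib, ← mul_neg, ← S.c_antisymm]
      have e2 : ∑ s, S.c i k s * S.c s j t = ∑ s, S.c k i s * S.c j s t :=
        Finset.sum_congr rfl fun s _ => by rw [S.c_antisymm i k, S.c_antisymm s j, neg_mul_neg]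
      rw [Finset.sum_sub_distrib, Finset.sum_add_distrib]
      linear_combination e - e1 - e2
    have comm (g : ι → A) (h : ι → ι → A) :
        (∑ t, (∑ s, g s * h s t) * f (t :: l)) = ∑ s, ∑ t, g s * (h s t * f (t :: l)) := by
      simp only [Finset.sum_mul, mul_assoc]
      exact Finset.sum_comm
    rw [comm, comm, comm] at hj
    linear_combination key + hj

/-- Lie derivatives commute with the differential. -/
theorem lie_diff (k : ι) {f : List ι → A} (hf : ListAntisymm f) (l : List ι) :
    S.lie k (S.diff f) l = S.diff (S.lie k f) l := by
  induction l generalizing f with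
  | nil => exact S.P_zero k
  | cons j l ih =>
    simp only [lie, diff, lie_sub, diff_sub, diff_sum_mul, mul_sub, Finset.sum_sub_distrib]
    linear_combination S.lie_lie_sub k j hf l - ih (hf.cons j)

theorem diff_diff {f : List ι → A} (hf : ListAntisymm f) (l : List ι) :
    S.diff (S.diff f) l = 0 := by
  induction l generalizing f with
  | nil => rfl
  | cons k l ih =>
    simp only [diff, diff_sub]
    linear_combination S.lie_diff k hf l + ih (hf.cons k)

/-- The Lie derivative as an explicit sum over positions. -/
theorem lie_ofFn (k : ι) {f : List ι → A} (hf : ListAntisymm f) {m : ℕ} (J : Fin (m + 1) → ι) :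
    S.lie k f (List.ofFn J) = S.P k (f (List.ofFn J)) -
      ∑ i : Fin (m + 1), (-1) ^ (i : ℕ) *
        ∑ s, S.c k (J i) s * f (s :: List.ofFn (J ∘ i.succAbove)) := by
  induction m generalizing f with
  | zero => simp [lie]
  | succ m ih =>
    obtain ⟨j, J, rfl⟩ : ∃ j J', J = Fin.cons j J' := ⟨J 0, Fin.tail J, (Fin.cons_self_tail J).symm⟩
    have hs (i : Fin (m + 1)) : List.ofFn ((Fin.cons j J : Fin (m + 2) → ι) ∘ i.succ.succAbove) =
        j :: List.ofFn (J ∘ i.succAbove) := by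
      simp [List.ofFn_succ, Function.comp_def]
    rw [Fin.sum_univ_succ]
    simp only [hs, List.ofFn_cons, lie, ih (hf.cons j), fun s l => hf.swap s j l]
    simp [Function.comp_def, pow_succ]
    ring

end InvolutiveSystem

section Operators

variable {n r : ℕ} {a : Fin r → Fin n → Euc n → ℂ} {a0 : Fin r → Euc n → ℂ}

theorem pOp_congr {g h : Euc n → ℂ} {x : Euc n} (e : g =ᶠ[nhds x] h) (j : Fin r) :
    pOp a j g x = pOp a j h x := by
  simp only [pOp, pd, e.fderiv_eq]

theorem POp_congr {g h : Euc n → ℂ} {x : Euc n} (e : g =ᶠ[nhds x] h) (j : Fin r) :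
    POp a a0 j g x = POp a a0 j h x := by
  simp only [POp, pOp_congr e, e.eq_of_nhds]

theorem POp_eventuallyEq {g h : Euc n → ℂ} {x : Euc n} (e : g =ᶠ[nhds x] h) (j : Fin r) :
    POp a a0 j g =ᶠ[nhds x] POp a a0 j h :=
  e.eventuallyEq_nhds.mono fun _ hy => POp_congr hy j

theorem POp_add {g h : Euc n → ℂ} {x : Euc n} (hg : DifferentiableAt ℝ g x)
    (hh : DifferentiableAt ℝ h x) (j : Fin r) :
    POp a a0 j (g + h) x = POp a a0 j g x + POp a a0 j h x := by
  simp only [POp, pOp, pd, fderiv_add hg hh, _root_.add_apply, mul_add,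
    Finset.sum_add_distrib, Pi.add_apply]
  ring

theorem POp_mul {g h : Euc n → ℂ} {x : Euc n} (hg : DifferentiableAt ℝ g x)
    (hh : DifferentiableAt ℝ h x) (j : Fin r) :
    POp a a0 j (g * h) x = pOp a j g x * h x + g x * POp a a0 j h x := by
  simp only [POp, pOp, pd, fderiv_mul hg hh, _root_.add_apply,
    _root_.smul_apply, smul_eq_mul, mul_add, Finset.sum_add_distrib, Pi.mul_apply,
    Finset.mul_sum, Finset.sum_mul]
  simp only [mul_left_comm (g x), mul_comm (h x), mul_assoc]
  ring

theorem contDiffOn_pOp {Ω : Set (Euc n)} (hΩ : IsOpen Ω)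
    (ha : ∀ j ν, ContDiffOn ℝ (⊤ : ℕ∞) (a j ν) Ω) {g : Euc n → ℂ}
    (hg : ContDiffOn ℝ (⊤ : ℕ∞) g Ω) (j : Fin r) : ContDiffOn ℝ (⊤ : ℕ∞) (pOp a j g) Ω := by
  refine ContDiffOn.sum fun ν _ => (ha j ν).mul ?_
  exact (hg.fderiv_of_isOpen hΩ (by simp)).clm_apply contDiffOn_const

theorem contDiffOn_POp {Ω : Set (Euc n)} (hΩ : IsOpen Ω)
    (ha : ∀ j ν, ContDiffOn ℝ (⊤ : ℕ∞) (a j ν) Ω) (ha0 : ∀ j, ContDiffOn ℝ (⊤ : ℕ∞) (a0 j) Ω)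
    {g : Euc n → ℂ} (hg : ContDiffOn ℝ (⊤ : ℕ∞) g Ω) (j : Fin r) :
    ContDiffOn ℝ (⊤ : ℕ∞) (POp a a0 j g) Ω :=
  (contDiffOn_pOp hΩ ha hg j).add ((ha0 j).mul hg)

/-- A function smooth on an open set agrees near any of its points with a globally smooth one. -/
theorem exists_contDiff_eventuallyEq {Ω : Set (Euc n)} (hΩ : IsOpen Ω) {g : Euc n → ℂ}
    (hg : ContDiffOn ℝ (⊤ : ℕ∞) g Ω) {x : Euc n} (hx : x ∈ Ω) :
    ∃ G : Euc n → ℂ, ContDiff ℝ (⊤ : ℕ∞) G ∧ G =ᶠ[nhds x] g := by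
  obtain ⟨ε, hε, hball⟩ := Metric.isOpen_iff.1 hΩ x hx
  let χ : ContDiffBump x := ⟨ε / 4, ε / 2, by positivity, by linarith⟩
  have hsupp : tsupport χ ⊆ Ω := by
    rw [χ.tsupport_eq]
    exact (Metric.closedBall_subset_ball (by change ε / 2 < ε; linarith)).trans hball
  refine ⟨fun y => χ y • g y, contDiff_iff_contDiffAt.2 fun y => ?_, ?_⟩
  · by_cases hy : y ∈ Ω
    · exact χ.contDiff.contDiffAt.smul (hg.contDiffAt (hΩ.mem_nhds hy))
    · have h0 : (fun y => χ y • g y) =ᶠ[nhds y] fun _ => 0 := by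
        filter_upwards [notMem_tsupport_iff_eventuallyEq.1 fun h => hy (hsupp h)] with z hz
        simp [hz]
      exact contDiffAt_const.congr_of_eventuallyEq h0
  · filter_upwards [χ.eventuallyEq_one] with y hy
    simp [hy]

/-- The commutation relations, tested on globally smooth functions, hold for functions which are
smooth on an open set. -/
theorem POp_bracket_of_contDiffOn {Ω : Set (Euc n)} (hΩ : IsOpen Ω)
    {c : Fin r → Fin r → Fin r → Euc n → ℂ}
    (hA1 : ∀ g : Euc n → ℂ, ContDiff ℝ (⊤ : ℕ∞) g → ∀ j k, ∀ x ∈ Ω,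
      POp a a0 j (POp a a0 k g) x - POp a a0 k (POp a a0 j g) x
        = ∑ l, c j k l x * POp a a0 l g x)
    {g : Euc n → ℂ} (hg : ContDiffOn ℝ (⊤ : ℕ∞) g Ω) (j k : Fin r) {x : Euc n} (hx : x ∈ Ω) :
    POp a a0 j (POp a a0 k g) x - POp a a0 k (POp a a0 j g) x
      = ∑ l, c j k l x * POp a a0 l g x := by
  obtain ⟨G, hG, e⟩ := exists_contDiff_eventuallyEq hΩ hg hx
  have h := hA1 G hG j k x hx
  simpa only [POp_congr (POp_eventuallyEq e _), POp_congr e] using h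

end Operators

/-- Extension by zero of a function on a set. -/
def zeroExt {n : ℕ} {Ω : Set (Euc n)} (g : Ω → ℂ) : Euc n → ℂ :=
  Function.extend Subtype.val g 0

theorem zeroExt_apply {n : ℕ} {Ω : Set (Euc n)} (g : Ω → ℂ) (x : Ω) : zeroExt g x = g x :=
  Subtype.val_injective.extend_apply g 0 x

/-- The ring of functions on `Ω` which are restrictions of functions smooth on `Ω`. -/
def smoothRing {n : ℕ} (Ω : Set (Euc n)) : Subring (Ω → ℂ) where
  carrier := {g | ∃ G : Euc n → ℂ, ContDiffOn ℝ (⊤ : ℕ∞) G Ω ∧ ∀ x : Ω, G x = g x}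
  mul_mem' := by
    rintro g h ⟨G, hG, eG⟩ ⟨H, hH, eH⟩
    exact ⟨G * H, hG.mul hH, fun x => by simp [eG, eH]⟩
  one_mem' := ⟨1, contDiffOn_const, fun _ => rfl⟩
  add_mem' := by
    rintro g h ⟨G, hG, eG⟩ ⟨H, hH, eH⟩
    exact ⟨G + H, hG.add hH, fun x => by simp [eG, eH]⟩
  zero_mem' := ⟨0, contDiffOn_const, fun _ => rfl⟩
  neg_mem' := by
    rintro g ⟨G, hG, eG⟩
    exact ⟨-G, hG.neg, fun x => by simp [eG]⟩

namespace smoothRing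

variable {n : ℕ} {Ω : Set (Euc n)}

/-- The restriction to `Ω` of a function smooth on `Ω`. -/
def ofContDiffOn {G : Euc n → ℂ} (hG : ContDiffOn ℝ (⊤ : ℕ∞) G Ω) : smoothRing Ω :=
  ⟨fun x => G x, G, hG, fun _ => rfl⟩

theorem contDiffOn_zeroExt (g : smoothRing Ω) : ContDiffOn ℝ (⊤ : ℕ∞) (zeroExt g.1) Ω := by
  obtain ⟨G, hG, e⟩ := g.2
  exact hG.congr fun x hx => (zeroExt_apply g.1 ⟨x, hx⟩).trans (e ⟨x, hx⟩).symm

theorem differentiableAt_zeroExt (hΩ : IsOpen Ω) (g : smoothRing Ω) (x : Ω) :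
    DifferentiableAt ℝ (zeroExt g.1) x :=
  ((contDiffOn_zeroExt g).contDiffAt (hΩ.mem_nhds x.2)).differentiableAt (by simp)

theorem zeroExt_eventuallyEq (hΩ : IsOpen Ω) {g : smoothRing Ω} {G : Euc n → ℂ}
    (e : ∀ x : Ω, g.1 x = G x) (x : Ω) : zeroExt g.1 =ᶠ[nhds (x : Euc n)] G := by
  filter_upwards [hΩ.mem_nhds x.2] with y hy
  exact (zeroExt_apply g.1 ⟨y, hy⟩).trans (e ⟨y, hy⟩)

end smoothRing

open smoothRing in
/-- The operators `P_j` form an involutive system over the ring of smooth functions. -/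
theorem exists_involutiveSystem {n r : ℕ} {Ω : Set (Euc n)} (hΩ : IsOpen Ω)
    {a : Fin r → Fin n → Euc n → ℂ} {a0 : Fin r → Euc n → ℂ}
    {c : Fin r → Fin r → Fin r → Euc n → ℂ}
    (ha : ∀ j ν, ContDiffOn ℝ (⊤ : ℕ∞) (a j ν) Ω) (ha0 : ∀ j, ContDiffOn ℝ (⊤ : ℕ∞) (a0 j) Ω)
    (hc : ∀ j k l, ContDiffOn ℝ (⊤ : ℕ∞) (c j k l) Ω)
    (hanti : ∀ j k i, ∀ x ∈ Ω, c j k i x = - c k j i x)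
    (hA1 : ∀ g : Euc n → ℂ, ContDiff ℝ (⊤ : ℕ∞) g → ∀ j k, ∀ x ∈ Ω,
      POp a a0 j (POp a a0 k g) x - POp a a0 k (POp a a0 j g) x
        = ∑ l, c j k l x * POp a a0 l g x)
    (hA2 : ∀ k k' l' l : Fin r, ∀ x ∈ Ω,
      (∑ s, c k k' s x * c s l' l x) + (∑ s, c k' l' s x * c s k l x) +
          (∑ s, c l' k s x * c s k' l x) =
        pOp a l' (c k k' l) x + pOp a k (c k' l' l) x + pOp a k' (c l' k l) x) :
    ∃ S : InvolutiveSystem (Fin r) (smoothRing Ω),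
      (∀ j g (x : Ω), (S.P j g).1 x = POp a a0 j (zeroExt g.1) x) ∧
      ∀ j k l (x : Ω), (S.c j k l).1 x = c j k l x := by
  refine ⟨{
    P := fun j g => ofContDiffOn (contDiffOn_POp hΩ ha ha0 (contDiffOn_zeroExt g) j)
    p := fun j g => ofContDiffOn (contDiffOn_pOp hΩ ha (contDiffOn_zeroExt g) j)
    c := fun j k l => ofContDiffOn (hc j k l)
    P_add := fun j g h => Subtype.ext (funext fun x => ?_)
    P_mul := fun j g h => Subtype.ext (funext fun x => ?_)
    c_antisymm := fun j k l => Subtype.ext (funext fun x => hanti j k l x x.2)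
    bracket := fun j k g => Subtype.ext (funext fun x => ?_)
    jacobi := fun k k' l' l => Subtype.ext (funext fun x => ?_) },
    fun _ _ _ => rfl, fun _ _ _ _ => rfl⟩
  · refine (POp_congr (zeroExt_eventuallyEq hΩ (fun y => ?_) x) j).trans
      (POp_add (differentiableAt_zeroExt hΩ g x) (differentiableAt_zeroExt hΩ h x) j)
    simp [zeroExt_apply]
  · refine (POp_congr (zeroExt_eventuallyEq hΩ (fun y => ?_) x) j).trans
      ((POp_mul (differentiableAt_zeroExt hΩ g x) (differentiableAt_zeroExt hΩ h x) j).trans ?_)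
    · simp [zeroExt_apply]
    · simp [zeroExt_apply, ofContDiffOn]
  · have h := POp_bracket_of_contDiffOn hΩ hA1 (contDiffOn_zeroExt g) j k x.2
    have e (i j : Fin r) : POp a a0 j (zeroExt (ofContDiffOn
        (contDiffOn_POp hΩ ha ha0 (contDiffOn_zeroExt g) i)).1) x =
        POp a a0 j (POp a a0 i (zeroExt g.1)) x :=
      POp_congr (zeroExt_eventuallyEq hΩ (fun _ => rfl) x) j
    rw [← e, ← e] at h
    simpa [ofContDiffOn] using h
  · have h := hA2 k k' l' l x x.2
    have e (i j k l : Fin r) : pOp a l (zeroExt (ofContDiffOn (hc i j k)).1) x =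
        pOp a l (c i j k) x :=
      pOp_congr (zeroExt_eventuallyEq hΩ (fun _ => rfl) x) l
    rw [← e, ← e, ← e] at h
    simpa [ofContDiffOn] using h

section Tuples

variable {n r : ℕ} {a : Fin r → Fin n → Euc n → ℂ} {a0 : Fin r → Euc n → ℂ}
  {c : Fin r → Fin r → Fin r → Euc n → ℂ}

theorem PP_zero (f : (Fin 0 → Fin r) → Euc n → ℂ) (J : Fin 1 → Fin r) (x : Euc n) :
    PP a a0 c 0 f J x = POp a a0 (J 0) (f (J ∘ Fin.succ)) x := by
  simp [PP]

theorem PP_succ (m : ℕ) (f : (Fin (m + 1) → Fin r) → Euc n → ℂ) (J : Fin (m + 2) → Fin r)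
    (x : Euc n) :
    PP a a0 c (m + 1) f J x =
      (∑ i : Fin (m + 2), (-1) ^ (i : ℕ) * POp a a0 (J i) (f (J ∘ i.succAbove)) x) -
      ∑ i : Fin (m + 2), ∑ j : Fin (m + 2), if hij : (i : ℕ) < (j : ℕ) then
        (-1 : ℂ) ^ ((i : ℕ) + (j : ℕ) + 1) * ∑ s : Fin r, c (J i) (J j) s x *
          f (Fin.cons s ((J ∘ j.succAbove) ∘ Fin.succAbove ⟨(i : ℕ), by omega⟩)) x
      else 0 := rfl

theorem cons_comp_succ_succAbove {m : ℕ} (k : Fin r) (J : Fin (m + 1) → Fin r)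
    (i : Fin (m + 1)) :
    (Fin.cons k J : Fin (m + 2) → Fin r) ∘ i.succ.succAbove = Fin.cons k (J ∘ i.succAbove) := by
  funext t
  refine Fin.cases ?_ (fun t => ?_) t <;> simp

theorem cons_comp_succ {m : ℕ} (k : Fin r) (J : Fin m → Fin r) :
    (Fin.cons k J : Fin (m + 1) → Fin r) ∘ Fin.succ = J := by
  funext t
  simp

/-- Cartan's formula for the compatibility operator in lowest degree. -/
theorem PP_cons_zero (f : (Fin 1 → Fin r) → Euc n → ℂ) (k : Fin r) (J : Fin 1 → Fin r)
    (x : Euc n) :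
    PP a a0 c 1 f (Fin.cons k J) x =
      POp a a0 k (f J) x - (∑ i : Fin 1, (-1) ^ (i : ℕ) *
        ∑ s, c k (J i) s x * f (Fin.cons s (J ∘ i.succAbove)) x) -
      PP a a0 c 0 (fun K => f (Fin.cons k K)) J x := by
  rw [PP_succ, PP_zero]
  simp only [Fin.sum_univ_succ (n := 1), Fin.succAbove_zero, cons_comp_succ, cons_comp_succ_succAbove]
  simp
  ring

/-- Cartan's formula for the compatibility operator in positive degree. -/
theorem PP_cons_succ (m : ℕ) (f : (Fin (m + 2) → Fin r) → Euc n → ℂ) (k : Fin r)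
    (J : Fin (m + 2) → Fin r) (x : Euc n)
    (hf : ∀ s (K : Fin m → Fin r),
      f (Fin.cons s (Fin.cons k K : Fin (m + 1) → Fin r)) x =
        -f (Fin.cons k (Fin.cons s K : Fin (m + 1) → Fin r)) x) :
    PP a a0 c (m + 2) f (Fin.cons k J) x =
      POp a a0 k (f J) x - (∑ i : Fin (m + 2), (-1) ^ (i : ℕ) *
        ∑ s, c k (J i) s x * f (Fin.cons s (J ∘ i.succAbove)) x) -
      PP a a0 c (m + 1) (fun K => f (Fin.cons k K)) J x := by
  have h (i j : Fin (m + 2)) (hi : (i : ℕ) + 1 < m + 2) :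
      (Fin.cons k (J ∘ j.succAbove) : Fin (m + 2) → Fin r) ∘
        Fin.succAbove ⟨(i : ℕ) + 1, hi⟩ =
      Fin.cons k ((J ∘ j.succAbove) ∘ Fin.succAbove ⟨(i : ℕ), by omega⟩) :=
    cons_comp_succ_succAbove k (J ∘ j.succAbove) ⟨i, by omega⟩
  have h0 (j : Fin (m + 2)) (h0 : 0 < m + 2) :
      (Fin.cons k (J ∘ j.succAbove) : Fin (m + 2) → Fin r) ∘ Fin.succAbove ⟨0, h0⟩ =
      J ∘ j.succAbove :=
    cons_comp_succ k (J ∘ j.succAbove)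
  rw [PP_succ, PP_succ]
  simp only [Fin.sum_univ_succ (n := m + 2), cons_comp_succ_succAbove, Fin.succAbove_zero,
    cons_comp_succ, Fin.val_succ, Fin.val_zero, h, h0, hf, Fin.cons_zero, Fin.cons_succ,
    add_lt_add_iff_right, Nat.not_lt_zero, dite_false, Nat.succ_pos, dite_true]
  have dite_neg_zero (p : Prop) [Decidable p] (u : p → ℂ) :
      (if h : p then -u h else 0) = -(if h : p then u h else 0) := by
    split_ifs <;> simp
  have e1 (i j : ℕ) : (-1 : ℂ) ^ (i + 1 + (j + 1) + 1) = (-1) ^ (i + j + 1) := by ring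
  have e2 (j : ℕ) : (-1 : ℂ) ^ (j + 1 + 1) = (-1) ^ j := by ring
  have e3 (j : ℕ) : (-1 : ℂ) ^ (j + 1) = -(-1) ^ j := by ring
  simp only [e1, e2, fun i : Fin (m + 2) => e3 i, neg_mul, mul_neg, Finset.sum_neg_distrib,
    dite_neg_zero, zero_add, pow_zero, one_mul]
  ring

/-- The compatibility operator agrees with the differential of cochains on lists. -/
theorem PP_eq_diff {Ω : Set (Euc n)} (hΩ : IsOpen Ω)
    {S : InvolutiveSystem (Fin r) (smoothRing Ω)}
    (hP : ∀ j g (x : Ω), (S.P j g).1 x = POp a a0 j (zeroExt g.1) x)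
    (hc : ∀ j k l (x : Ω), (S.c j k l).1 x = c j k l x)
    {F : List (Fin r) → smoothRing Ω} (hF : ListAntisymm F) {m : ℕ}
    {f : (Fin m → Fin r) → Euc n → ℂ} (hf : ∀ J (x : Ω), (F (List.ofFn J)).1 x = f J x)
    (J : Fin (m + 1) → Fin r) (x : Ω) :
    PP a a0 c m f J x = (S.diff F (List.ofFn J)).1 x := by
  have hPf {m : ℕ} {F : List (Fin r) → smoothRing Ω} {f : (Fin m → Fin r) → Euc n → ℂ}
      (hf : ∀ J (x : Ω), (F (List.ofFn J)).1 x = f J x) (k : Fin r) (K : Fin m → Fin r) :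
      POp a a0 k (f K) x = (S.P k (F (List.ofFn K))).1 x :=
    ((hP k _ x).trans (POp_congr (smoothRing.zeroExt_eventuallyEq hΩ (hf K) x) k)).symm
  obtain ⟨k, J, rfl⟩ : ∃ k J', J = Fin.cons k J' := ⟨J 0, Fin.tail J, (Fin.cons_self_tail J).symm⟩
  induction m generalizing F k with
  | zero =>
    rw [PP_zero, hPf hf]
    simp [InvolutiveSystem.diff, InvolutiveSystem.lie]
  | succ m ih =>
    have cartan : PP a a0 c (m + 1) f (Fin.cons k J) x =
        POp a a0 k (f J) x - (∑ i : Fin (m + 1), (-1) ^ (i : ℕ) *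
          ∑ s, c k (J i) s x * f (Fin.cons s (J ∘ i.succAbove)) x) -
        PP a a0 c m (fun K => f (Fin.cons k K)) J x := by
      cases m with
      | zero => exact PP_cons_zero f k J x
      | succ m =>
        refine PP_cons_succ m f k J x fun s K => ?_
        rw [← hf, ← hf]
        simp only [List.ofFn_cons, hF.swap s k]
        rfl
    have hf' (K : Fin m → Fin r) (y : Ω) :
        (F (k :: List.ofFn K)).1 y = f (Fin.cons k K) y := by
      rw [← hf, List.ofFn_cons]
    obtain ⟨j, J, rfl⟩ : ∃ j J', J = Fin.cons j J' :=
      ⟨J 0, Fin.tail J, (Fin.cons_self_tail J).symm⟩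
    rw [cartan, hPf hf, ih (hF.cons k) hf']
    rw [List.ofFn_cons k, InvolutiveSystem.diff, S.lie_ofFn k hF]
    simp [← hc, ← hf, Function.comp_def]

end Tuples

/-- The extension by zero of a function of `m`-tuples to a function of lists. -/
def listExt {ι A : Type*} [Zero A] {m : ℕ} (f : (Fin m → ι) → A) (l : List ι) : A :=
  if h : l.length = m then f fun i => l.get (i.cast h.symm) else 0

theorem listExt_ofFn {ι A : Type*} [Zero A] {m : ℕ} (f : (Fin m → ι) → A) (J : Fin m → ι) :
    listExt f (List.ofFn J) = f J := by
  simp [listExt]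

theorem listExt_antisymm {ι A : Type*} [AddCommGroup A] {m : ℕ} {f : (Fin m → ι) → A}
    (hf : ∀ J i j, i ≠ j → f (J ∘ Equiv.swap i j) = -f J) : ListAntisymm (listExt f) := by
  intro pre a b l
  by_cases h : (pre ++ b :: a :: l).length = m
  · have h' : (pre ++ a :: b :: l).length = m := by simpa using h
    have hlen : pre.length + 1 < m := by
      simp only [List.length_append, List.length_cons] at h
      omega
    rw [listExt, listExt, dif_pos h, dif_pos h',
      ← hf _ ⟨pre.length, by omega⟩ ⟨pre.length + 1, hlen⟩ (by simp)]
    congr 1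
    funext i
    rw [Function.comp_apply, Equiv.swap_apply_def]
    simp only [Fin.ext_iff]
    split_ifs with h1 h2
    · simp [h1]
    · simp [h2]
    · simp [List.getElem_append, List.getElem_cons]
      grind
  · have h' : ¬ (pre ++ a :: b :: l).length = m := by simpa using h
    rw [listExt, listExt, dif_neg h, dif_neg h', neg_zero]

/-- under (A1) and (A2) the sequence of operators `𝒫_q` is a complex:
`𝒫_{q+1} ∘ 𝒫_q = 0`. -/
theorem stmt_2 {n r : ℕ} (Ω : Set (Euc n)) (hΩ : IsOpen Ω)
    (a : Fin r → Fin n → Euc n → ℂ) (a0 : Fin r → Euc n → ℂ)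
    (c : Fin r → Fin r → Fin r → Euc n → ℂ)
    (ha : ∀ j ν, ContDiffOn ℝ (⊤ : ℕ∞) (a j ν) Ω) (ha0 : ∀ j, ContDiffOn ℝ (⊤ : ℕ∞) (a0 j) Ω)
    (hc : ∀ j k l, ContDiffOn ℝ (⊤ : ℕ∞) (c j k l) Ω)
    -- (A1): involutivity with antisymmetric structure functions
    (hanti : ∀ j k i, ∀ x ∈ Ω, c j k i x = - c k j i x)
    (hA1 : ∀ g : Euc n → ℂ, ContDiff ℝ (⊤ : ℕ∞) g → ∀ j k, ∀ x ∈ Ω,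
      POp a a0 j (POp a a0 k g) x - POp a a0 k (POp a a0 j g) x
        = ∑ l, c j k l x * POp a a0 l g x)
    -- (A2): the Jacobi-type identity for the structure functions
    (hA2 : ∀ k k' l' l : Fin r, ∀ x ∈ Ω,
      (∑ s, c k k' s x * c s l' l x) + (∑ s, c k' l' s x * c s k l x) +
          (∑ s, c l' k s x * c s k' l x) =
        pOp a l' (c k k' l) x + pOp a k (c k' l' l) x + pOp a k' (c l' k l) x)
    -- `f` is a smooth antisymmetric `(q-1)`-tuple, `q = m+1`, `1 ≤ q ≤ r`
    (m : ℕ) (hq : m + 1 ≤ r)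
    (f : (Fin m → Fin r) → Euc n → ℂ)
    (hfsm : ∀ J, ContDiffOn ℝ (⊤ : ℕ∞) (f J) Ω)
    (hfalt : ∀ (J : Fin m → Fin r) (σ : Equiv.Perm (Fin m)) (x : Euc n),
      f (J ∘ σ) x = ((Equiv.Perm.sign σ : ℤ) : ℂ) * f J x)
    (hfz : ∀ (J : Fin m → Fin r) (x : Euc n), ¬ Function.Injective J → f J x = 0) :
    ∀ J : Fin (m + 2) → Fin r, ∀ x ∈ Ω,
      PP a a0 c (m + 1) (PP a a0 c m f) J x = 0 := by
  intro J x hx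
  obtain ⟨S, hP, hcS⟩ := exists_involutiveSystem hΩ ha ha0 hc hanti hA1 hA2
  let f' : (Fin m → Fin r) → smoothRing Ω := fun J => smoothRing.ofContDiffOn (hfsm J)
  have hF : ListAntisymm (listExt f') := listExt_antisymm fun J i j hij =>
    Subtype.ext (funext fun y => (hfalt J (Equiv.swap i j) y).trans (by
      simp [Equiv.Perm.sign_swap hij, f', smoothRing.ofContDiffOn]))
  have hf (K : Fin m → Fin r) (y : Ω) : (listExt f' (List.ofFn K)).1 y = f K y := by
    rw [listExt_ofFn]
    rfl
  refine (PP_eq_diff hΩ hP hcS (S.diff_antisymm hF)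
    (fun K y => (PP_eq_diff hΩ hP hcS hF hf K y).symm) J ⟨x, hx⟩).trans ?_
  rw [S.diff_diff hF]
  rfl
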